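/- Let m ≥ 1, let α₁,…,α_m > 0 and α = α₁+⋯+α_m. If 𝒜_m^h := Ω_Q^{-m} ∫_{{(y₁,…,y_m) : (|y₁|_h²+⋯+|y_m|_h²)^{1/2} < 1}} ∏_{i=1}^m |y_i|_h^{-α_i} dy₁⋯dy_m < ∞, then for all f_i ∈ H^∞_{α_i}(ℍⁿ) one has ‖𝔥_m^h(f₁,…,f_m)‖_{H^∞_α} ≤ 𝒜_m^h ∏_{i=1}^m ‖f_i‖_{H^∞_{α_i}}; in particular the m-linear Hardy operator 𝔥_m^h is bounded from H^∞_{α₁}(ℍⁿ)×⋯×H^∞_{α_m}(ℍⁿ) to H^∞_α(ℍⁿ). -/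

import Mathlib

open MeasureTheory ENNReal

/-- The Korányi (homogeneous) norm on the Heisenberg group `ℍⁿ ≃ ℝ^{2n+1}`. -/
noncomputable def hnorm (n : ℕ) (x : Fin (2*n+1) → ℝ) : ℝ :=
  ((∑ i : Fin (2*n+1), if (i : ℕ) < 2*n then (x i)^2 else 0)^2
    + (x (Fin.last (2*n)))^2) ^ ((1:ℝ)/4)

/-- The Heisenberg dilations `δ_r`. -/
noncomputable def dil (n : ℕ) (r : ℝ) (x : Fin (2*n+1) → ℝ) : Fin (2*n+1) → ℝ :=
  fun i => if (i : ℕ) < 2*n then r * x i else r^2 * x i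

/-- The norm of the weighted-type space `H^∞_α(ℍⁿ)`:
`‖f‖ = ess sup_x |x|_h^α |f x|`. -/
noncomputable def wnorm (n : ℕ) (α : ℝ) (f : (Fin (2*n+1) → ℝ) → ℝ) : ℝ≥0∞ :=
  essSup (fun x => ENNReal.ofReal (hnorm n x ^ α * |f x|)) volume

/-- `Ω_Q`: the volume of the Korányi unit ball. -/
noncomputable def ΩQ (n : ℕ) : ℝ :=
  (volume {x : Fin (2*n+1) → ℝ | hnorm n x < 1}).toReal

lemma hnorm_nonneg' (n : ℕ) (x : Fin (2*n+1) → ℝ) : 0 ≤ hnorm n x := by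
  unfold hnorm; positivity

lemma continuous_hnorm' (n : ℕ) : Continuous (hnorm n) := by
  unfold hnorm
  refine Continuous.rpow_const ?_ (fun _ => Or.inr (by norm_num))
  refine Continuous.add (Continuous.pow (continuous_finsetSum _ fun i _ => ?_) 2) (by fun_prop)
  split_ifs <;> fun_prop

lemma eq_zero_of_hnorm' (n : ℕ) (x : Fin (2*n+1) → ℝ) (h : hnorm n x = 0) : x = 0 := by
  unfold hnorm at h
  rw [Real.rpow_eq_zero (by positivity) (by norm_num)] at h
  have hs : 0 ≤ ∑ i : Fin (2*n+1), (if (i : ℕ) < 2*n then (x i)^2 else 0) :=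
    Finset.sum_nonneg fun i _ => by split_ifs <;> positivity
  have h1 : (∑ i : Fin (2*n+1), (if (i : ℕ) < 2*n then (x i)^2 else 0)) = 0 := by
    nlinarith [sq_nonneg (x (Fin.last (2*n)))]
  have h2 : x (Fin.last (2*n)) = 0 := by
    rw [h1] at h; simpa using h
  rw [Finset.sum_eq_zero_iff_of_nonneg (fun i _ => by split_ifs <;> positivity)] at h1
  funext i
  by_cases hi : (i : ℕ) < 2*n
  · have := h1 i (Finset.mem_univ _)
    simpa [hi] using this
  · have : i = Fin.last (2*n) := by
      apply Fin.ext; simp; omega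
    rw [this]; simpa using h2

lemma hnorm_dil' (n : ℕ) (R : ℝ) (hR : 0 < R) (x : Fin (2*n+1) → ℝ) :
    hnorm n (dil n R x) = R * hnorm n x := by
  unfold hnorm dil
  have h1 : (∑ i : Fin (2*n+1), (if (i : ℕ) < 2*n then
      (if (i : ℕ) < 2*n then R * x i else R^2 * x i)^2 else 0))
      = R^2 * ∑ i : Fin (2*n+1), (if (i : ℕ) < 2*n then (x i)^2 else 0) := by
    rw [Finset.mul_sum]
    refine Finset.sum_congr rfl fun i _ => ?_
    split_ifs <;> ring
  rw [h1]
  have hR4 : R = (R^4) ^ ((1:ℝ)/4) := by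
    rw [← Real.rpow_natCast, ← Real.rpow_mul hR.le]; norm_num
  conv_rhs => rw [hR4]
  rw [← Real.mul_rpow (by positivity) (by positivity)]
  congr 1
  simp
  ring

noncomputable def dilLin' (n : ℕ) (R : ℝ) : (Fin (2*n+1) → ℝ) →ₗ[ℝ] (Fin (2*n+1) → ℝ) :=
  Matrix.toLin' (Matrix.diagonal fun i : Fin (2*n+1) => if (i : ℕ) < 2*n then R else R^2)

lemma dilLin_apply' (n : ℕ) (R : ℝ) (x : Fin (2*n+1) → ℝ) : dilLin' n R x = dil n R x := by
  funext i
  simp only [dilLin', dil, Matrix.toLin'_apply, Matrix.mulVec_diagonal]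
  split_ifs <;> rfl

lemma dilLin_det' (n : ℕ) (R : ℝ) : LinearMap.det (dilLin' n R) = R ^ (2*n+2) := by
  rw [dilLin', LinearMap.det_toLin', Matrix.det_diagonal, Fin.prod_univ_castSucc]
  simp
  ring

noncomputable def dilPi' (n m : ℕ) (R : ℝ) :
    (Fin m → Fin (2*n+1) → ℝ) →ₗ[ℝ] (Fin m → Fin (2*n+1) → ℝ) :=
  LinearMap.pi fun i => (dilLin' n R).comp (LinearMap.proj i)

lemma dilPi_apply' (n m : ℕ) (R : ℝ) (y : Fin m → Fin (2*n+1) → ℝ) (i : Fin m) :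
    dilPi' n m R y i = dil n R (y i) := by
  simp [dilPi', dilLin_apply']

lemma dilPi_det' (n m : ℕ) (R : ℝ) : LinearMap.det (dilPi' n m R) = (R ^ (2*n+2)) ^ m := by
  rw [dilPi', LinearMap.det_pi]
  simp [dilLin_det']

def bal' (n m : ℕ) (R : ℝ) : Set (Fin m → Fin (2*n+1) → ℝ) :=
  {y | Real.sqrt (∑ i, hnorm n (y i) ^ 2) < R}

lemma measurableSet_bal' (n m : ℕ) (R : ℝ) : MeasurableSet (bal' n m R) := by
  refine measurableSet_lt (Continuous.measurable ?_) measurable_const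
  refine Real.continuous_sqrt.comp (continuous_finsetSum _ fun i _ => ?_)
  exact ((continuous_hnorm' n).comp (continuous_apply i)).pow 2

lemma measurable_ker' (n m : ℕ) (α : Fin m → ℝ) :
    Measurable (fun y : Fin m → Fin (2*n+1) → ℝ => ∏ i, hnorm n (y i) ^ (-(α i))) := by
  refine Finset.measurable_prod _ fun i _ => ?_
  exact (((continuous_hnorm' n).measurable.comp (measurable_pi_apply i))).pow_const _

lemma scaling' (n m : ℕ) (α : Fin m → ℝ) (R : ℝ) (hR : 0 < R)
    (hfin : IntegrableOn (fun y : Fin m → Fin (2*n+1) → ℝ => ∏ i, hnorm n (y i) ^ (-(α i)))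
      (bal' n m 1)) :
    IntegrableOn (fun y : Fin m → Fin (2*n+1) → ℝ => ∏ i, hnorm n (y i) ^ (-(α i)))
      (bal' n m R) ∧
    ∫ y in bal' n m R, ∏ i, hnorm n (y i) ^ (-(α i)) =
      ((R ^ (2*n+2)) ^ m) * (R ^ (-(∑ i, α i)) *
        ∫ y in bal' n m 1, ∏ i, hnorm n (y i) ^ (-(α i))) := by
  set g : (Fin m → Fin (2*n+1) → ℝ) → ℝ := fun y => ∏ i, hnorm n (y i) ^ (-(α i)) with hg
  have hgm : Measurable g := measurable_ker' n m α
  have hd : LinearMap.det (dilPi' n m R) ≠ 0 := by rw [dilPi_det']; positivity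
  have hmap := Measure.map_linearMap_addHaar_eq_smul_addHaar
    (volume : Measure (Fin m → Fin (2*n+1) → ℝ)) hd
  have hDm : Measurable (dilPi' n m R) :=
    (LinearMap.continuous_of_finiteDimensional (dilPi' n m R)).measurable
  have hD : ∀ y, (bal' n m R).indicator g (dilPi' n m R y)
      = R ^ (-(∑ i, α i)) * (bal' n m 1).indicator g y := by
    intro y
    have hs : Real.sqrt (∑ i, hnorm n (dilPi' n m R y i) ^ 2)
        = R * Real.sqrt (∑ i, hnorm n (y i) ^ 2) := by
      simp_rw [dilPi_apply', hnorm_dil' n R hR, mul_pow]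
      rw [← Finset.mul_sum, Real.sqrt_mul (by positivity), Real.sqrt_sq hR.le]
    have hmem : dilPi' n m R y ∈ bal' n m R ↔ y ∈ bal' n m 1 := by
      simp only [bal', Set.mem_setOf_eq]
      rw [hs]
      constructor
      · intro h; nlinarith
      · intro h; nlinarith
    have hgD : g (dilPi' n m R y) = R ^ (-(∑ i, α i)) * g y := by
      simp only [hg, dilPi_apply', hnorm_dil' n R hR]
      rw [← Finset.sum_neg_distrib, Real.rpow_sum_of_pos hR, ← Finset.prod_mul_distrib]
      exact Finset.prod_congr rfl fun i _ => Real.mul_rpow hR.le (hnorm_nonneg' _ _)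
    by_cases hy : y ∈ bal' n m 1
    · rw [Set.indicator_of_mem hy, Set.indicator_of_mem (hmem.2 hy), hgD]
    · rw [Set.indicator_of_notMem hy, Set.indicator_of_notMem (fun h => hy (hmem.1 h)), mul_zero]
  have hGm : Measurable ((bal' n m R).indicator g) := hgm.indicator (measurableSet_bal' n m R)
  have hdet : |(LinearMap.det (dilPi' n m R))⁻¹| = ((R ^ (2*n+2)) ^ m)⁻¹ := by
    rw [dilPi_det', abs_of_pos (by positivity)]
  rw [hdet] at hmap
  have hpos : 0 < ((R ^ (2*n+2)) ^ m)⁻¹ := by positivity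
  constructor
  · rw [← integrable_indicator_iff (measurableSet_bal' n m R)]
    have h1 : Integrable ((bal' n m R).indicator g) (Measure.map (dilPi' n m R) volume) := by
      rw [integrable_map_measure hGm.aestronglyMeasurable hDm.aemeasurable]
      have : (bal' n m R).indicator g ∘ (dilPi' n m R)
        = fun y => R ^ (-(∑ i, α i)) * (bal' n m 1).indicator g y := funext hD
      rw [this]
      exact ((integrable_indicator_iff (measurableSet_bal' n m 1)).2 hfin).const_mul _
    rw [hmap] at h1
    exact (integrable_smul_measure (by simpa using hpos) ENNReal.ofReal_ne_top).1 h1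
  · rw [← integral_indicator (measurableSet_bal' n m R),
      ← integral_indicator (measurableSet_bal' n m 1)]
    have h1 := integral_map (μ := volume) hDm.aemeasurable
      (hGm.aestronglyMeasurable (μ := Measure.map (dilPi' n m R) volume))
    rw [hmap, integral_smul_measure, ENNReal.toReal_ofReal hpos.le] at h1
    simp_rw [hD] at h1
    rw [integral_const_mul, smul_eq_mul] at h1
    rw [← h1, mul_inv_cancel_left₀ (by positivity)]

/-- boundedness of the `m`-linear Hardy operator on the Heisenberg group
from `H^∞_{α₁} × ⋯ × H^∞_{α_m}` to `H^∞_α`, with constant `𝒜_m^h`. -/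
theorem statement3 (n : ℕ) (hn : 1 ≤ n) (m : ℕ) (hm : 1 ≤ m)
    (α : Fin m → ℝ) (hα : ∀ i, 0 < α i)
    (Q : ℝ) (hQ : Q = 2*n+2)
    (A : ℝ)
    (hA : A = (ΩQ n ^ m)⁻¹ *
      ∫ y in {y : Fin m → Fin (2*n+1) → ℝ | Real.sqrt (∑ i, hnorm n (y i) ^ 2) < 1},
        ∏ i, hnorm n (y i) ^ (-(α i)))
    (hAfin : IntegrableOn (fun y : Fin m → Fin (2*n+1) → ℝ => ∏ i, hnorm n (y i) ^ (-(α i)))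
      {y : Fin m → Fin (2*n+1) → ℝ | Real.sqrt (∑ i, hnorm n (y i) ^ 2) < 1})
    (f : Fin m → (Fin (2*n+1) → ℝ) → ℝ)
    (hfmeas : ∀ i, Measurable (f i))
    (hfnonneg : ∀ i, ∀ y, 0 ≤ f i y)
    (hffin : ∀ i, wnorm n (α i) (f i) < ⊤) :
    wnorm n (∑ i, α i)
        (fun x => (ΩQ n ^ m)⁻¹ * (hnorm n x ^ ((m : ℝ) * Q))⁻¹ *
          ∫ y in {y : Fin m → Fin (2*n+1) → ℝ |
              Real.sqrt (∑ i, hnorm n (y i) ^ 2) < hnorm n x},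
            ∏ i, f i (y i))
      ≤ ENNReal.ofReal A * ∏ i, wnorm n (α i) (f i) := by
  set C : Fin m → ℝ := fun i => (wnorm n (α i) (f i)).toReal with hC
  have hCn : ∀ i, 0 ≤ C i := fun i => ENNReal.toReal_nonneg
  have hCw : ∀ i, wnorm n (α i) (f i) = ENNReal.ofReal (C i) := fun i =>
    (ENNReal.ofReal_toReal (hffin i).ne).symm
  have hne : ∀ᵐ y : Fin (2*n+1) → ℝ, y ≠ 0 := by
    rw [ae_iff]; simp
  have hb1 : ∀ i, ∀ᵐ y : Fin (2*n+1) → ℝ, f i y ≤ C i * hnorm n y ^ (-(α i)) := by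
    intro i
    have h := ENNReal.ae_le_essSup (μ := volume)
      (fun x : Fin (2*n+1) → ℝ => ENNReal.ofReal (hnorm n x ^ α i * |f i x|))
    filter_upwards [h, hne] with y hy hy0
    have hpos : 0 < hnorm n y := lt_of_le_of_ne (hnorm_nonneg' n y)
      (fun h => hy0 (eq_zero_of_hnorm' n y h.symm))
    change _ ≤ wnorm n (α i) (f i) at hy
    rw [hCw i, ENNReal.ofReal_le_ofReal_iff (hCn i), abs_of_nonneg (hfnonneg i y)] at hy
    rw [Real.rpow_neg hpos.le, ← div_eq_mul_inv, le_div_iff₀ (Real.rpow_pos_of_pos hpos _)]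
    linarith
  have hb : ∀ᵐ y : Fin m → Fin (2*n+1) → ℝ, ∀ i, f i (y i) ≤ C i * hnorm n (y i) ^ (-(α i)) := by
    rw [ae_all_iff]
    intro i
    exact (Measure.tendsto_eval_ae_ae (μ := fun _ : Fin m =>
      (volume : Measure (Fin (2*n+1) → ℝ))) (i := i)).eventually (hb1 i)
  simp_rw [hCw]
  rw [← ENNReal.ofReal_prod_of_nonneg (fun i _ => hCn i)]
  have hAn : 0 ≤ A := by
    rw [hA]
    refine mul_nonneg (inv_nonneg.2 (pow_nonneg ENNReal.toReal_nonneg _)) ?_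
    exact integral_nonneg fun y => Finset.prod_nonneg fun i _ =>
      Real.rpow_nonneg (hnorm_nonneg' _ _) _
  rw [← ENNReal.ofReal_mul hAn]
  have hprod : 0 ≤ ∏ i, C i := Finset.prod_nonneg fun i _ => hCn i
  have hsum : 0 < ∑ i, α i := Finset.sum_pos (fun i _ => hα i) ⟨⟨0, hm⟩, Finset.mem_univ _⟩
  refine essSup_le_of_ae_le _ (Filter.Eventually.of_forall fun x => ?_)
  refine ENNReal.ofReal_le_ofReal ?_
  rcases (hnorm_nonneg' n x).eq_or_lt with h0 | hR
  · rw [← h0, Real.zero_rpow hsum.ne', zero_mul]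
    positivity
  obtain ⟨hint, hval⟩ := scaling' n m α (hnorm n x) hR hAfin
  have hle : ∫ y in bal' n m (hnorm n x), ∏ i, f i (y i)
      ≤ ∫ y in bal' n m (hnorm n x), (∏ i, C i) * ∏ i, hnorm n (y i) ^ (-(α i)) := by
    refine integral_mono_of_nonneg
      (Filter.Eventually.of_forall fun y => Finset.prod_nonneg fun i _ => hfnonneg i _)
      (hint.const_mul _) ?_
    filter_upwards [ae_restrict_of_ae hb] with y hy
    rw [← Finset.prod_mul_distrib]
    exact Finset.prod_le_prod (fun i _ => hfnonneg i _) fun i _ => hy i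
  rw [integral_const_mul, hval] at hle
  change _ * |_ * _ * ∫ y in bal' n m (hnorm n x), ∏ i, f i (y i)| ≤ _
  change A = _ * ∫ y in bal' n m 1, _ at hA
  have hΩ : 0 ≤ (ΩQ n ^ m)⁻¹ := inv_nonneg.2 (pow_nonneg ENNReal.toReal_nonneg _)
  have hI : 0 ≤ ∫ y in bal' n m (hnorm n x), ∏ i, f i (y i) :=
    integral_nonneg fun y => Finset.prod_nonneg fun i _ => hfnonneg i _
  have hp : hnorm n x ^ ((m:ℝ) * Q) = (hnorm n x ^ (2*n+2)) ^ m := by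
    rw [← pow_mul, ← Real.rpow_natCast, hQ]
    congr 1; push_cast; ring
  rw [hp]
  generalize hJ : ∫ y in bal' n m (hnorm n x), ∏ i, f i (y i) = J at *
  rw [hA]
  generalize hK : ∫ y in bal' n m 1, ∏ i, hnorm n (y i) ^ (-(α i)) = K at *
  rw [Real.rpow_neg hR.le] at hle
  have hS : 0 < hnorm n x ^ (∑ i, α i) := Real.rpow_pos_of_pos hR _
  have hT : 0 < (hnorm n x ^ (2*n+2)) ^ m := by positivity
  generalize hnorm n x ^ (∑ i, α i) = S at *
  generalize (hnorm n x ^ (2*n+2)) ^ m = T at *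
  generalize (ΩQ n ^ m)⁻¹ = W at *
  generalize (∏ i, C i) = P at *
  rw [abs_of_nonneg (by positivity)]
  calc S * (W * T⁻¹ * J) ≤ S * (W * T⁻¹ * (P * (T * (S⁻¹ * K)))) := by gcongr
    _ = W * K * P := by field_simp
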